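/- Suppose there exists an interpolating classifier θ′ ∈ Θ, i.e., E_{(x,y)∼D}[ℓ(f_{θ′}(x), y)] = 0. Then every ν★ ≥ 0 attaining the supremum of the dual function d(ν) := inf_{θ ∈ Θ} L(θ, ν) over ν ≥ 0 satisfies ν★ ≤ ρ^{−1} E_{(x,y)∼D}[ max_{δ∈Δ} ℓ(f_{θ′}(x+δ), y) ]. (Bound (E:nu_bound) on the optimal dual variable in Proposition 3.6.) -/

import Mathlib

open MeasureTheory Set

noncomputable section

/-- The Lagrangian `L(θ,ν) = E[max_{δ∈Δ} ℓ(f_θ(x+δ),y)] + ν (E[ℓ(f_θ(x),y)] − ρ)`. -/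
def popLagrangian {d K p : ℕ} (D : Measure ((Fin d → ℝ) × Fin K))
    (Δ : Set (Fin d → ℝ)) (f : (Fin p → ℝ) → (Fin d → ℝ) → (Fin K → ℝ))
    (ℓ : (Fin K → ℝ) → Fin K → ℝ) (ρ : ℝ) (θ : Fin p → ℝ) (ν : ℝ) : ℝ :=
  (∫ ω, (⨆ δ ∈ Δ, ℓ (f θ (ω.1 + δ)) ω.2) ∂D)
    + ν * ((∫ ω, ℓ (f θ ω.1) ω.2 ∂D) - ρ)

/-- **bound (E:nu_bound) on the optimal dual variable.** If there is an
interpolating classifier `θ' ∈ Θ`, i.e. `E[ℓ(f_{θ'}(x),y)] = 0`, then every `ν★ ≥ 0`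
attaining the supremum of the dual function `d(ν) := inf_{θ∈Θ} L(θ,ν)` over `ν ≥ 0`
satisfies `ν★ ≤ ρ⁻¹ E[ max_{δ∈Δ} ℓ(f_{θ'}(x+δ), y) ]`. -/
theorem optimal_dual_variable_bound
    {d K p : ℕ}
    (X : Set (Fin d → ℝ)) (hX : IsCompact X)
    (D : Measure ((Fin d → ℝ) × Fin K)) [IsProbabilityMeasure D]
    (hsupp : ∀ᵐ ω ∂D, ω.1 ∈ X)
    (Δ : Set (Fin d → ℝ)) (hΔ : IsCompact Δ)
    (Θ : Set (Fin p → ℝ)) (hΘ : IsCompact Θ)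
    (f : (Fin p → ℝ) → (Fin d → ℝ) → (Fin K → ℝ))
    (hf : ∀ θ, Continuous (f θ))
    (hfS : ∀ θ x, f θ x ∈ stdSimplex ℝ (Fin K))
    (B ρ : ℝ) (hρ : 0 < ρ)
    (ℓ : (Fin K → ℝ) → Fin K → ℝ)
    (hℓbdd : ∀ v ∈ stdSimplex ℝ (Fin K), ∀ y, ℓ v y ∈ Icc 0 B)
    (θ' : Fin p → ℝ) (hθ' : θ' ∈ Θ)
    (hinterp : (∫ ω, ℓ (f θ' ω.1) ω.2 ∂D) = 0)
    (νs : ℝ) (hνs : 0 ≤ νs)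
    (hmax : ∀ ν ∈ Ici (0:ℝ),
      (⨅ θ ∈ Θ, popLagrangian D Δ f ℓ ρ θ ν) ≤ ⨅ θ ∈ Θ, popLagrangian D Δ f ℓ ρ θ νs) :
    νs ≤ ρ⁻¹ * ∫ ω, (⨆ δ ∈ Δ, ℓ (f θ' (ω.1 + δ)) ω.2) ∂D := by
  have hA : ∀ θ, 0 ≤ ∫ ω, (⨆ δ ∈ Δ, ℓ (f θ (ω.1 + δ)) ω.2) ∂D := fun θ =>
    integral_nonneg fun ω => Real.iSup_nonneg fun δ => Real.iSup_nonneg fun _ =>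
      (hℓbdd _ (hfS _ _) _).1
  have hC : ∀ θ, 0 ≤ ∫ ω, ℓ (f θ ω.1) ω.2 ∂D := fun θ =>
    integral_nonneg fun ω => (hℓbdd _ (hfS _ _) _).1
  have h0 : 0 ≤ ⨅ θ ∈ Θ, popLagrangian D Δ f ℓ ρ θ 0 := by
    refine Real.iInf_nonneg fun θ => Real.iInf_nonneg fun _ => ?_
    unfold popLagrangian
    rw [zero_mul, add_zero]
    exact hA θ
  have hL : ∀ θ, -(νs * ρ) ≤ popLagrangian D Δ f ℓ ρ θ νs := by
    intro θ
    unfold popLagrangian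
    have h1 := hA θ
    have h2 := mul_nonneg hνs (hC θ)
    rw [mul_sub]
    linarith
  have hbdd : BddBelow (Set.range fun θ => ⨅ (_ : θ ∈ Θ), popLagrangian D Δ f ℓ ρ θ νs) := by
    refine ⟨-(νs * ρ), ?_⟩
    rintro _ ⟨θ, rfl⟩
    by_cases h : θ ∈ Θ
    · simpa [h] using hL θ
    · simp [h, Real.iInf_of_isEmpty]
      positivity
  have h1 : (⨅ θ ∈ Θ, popLagrangian D Δ f ℓ ρ θ νs) ≤ popLagrangian D Δ f ℓ ρ θ' νs := by
    refine (ciInf_le hbdd θ').trans ?_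
    simp [hθ']
  have h2 := (h0.trans (hmax 0 (by simp))).trans h1
  unfold popLagrangian at h2
  rw [hinterp] at h2
  rw [inv_mul_eq_div, le_div_iff₀ hρ]
  linarith

end
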